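/- Fix integers N ≥ 0 and p,q ≥ 0. Define functions g_0, g_1, …, g_N on [0,1] by g_0(x) = x^p/p! and g_{m+1}(x) = ∫_0^{1−x} g_m(y) dy for 0 ≤ m < N. Then ∫_0^1 g_N(x) · (x^q/q!) dx = X_N(p,q). (That is, X_N(p,q) = ⟨T^N(x^p/p!), x^q/q!⟩ where T is the Elkies transfer operator (Tf)(x) = ∫_0^{1−x} f(y)dy.) -/

import Mathlib

/-- The number of up-down (alternating) permutations of `{1, …, j}`:
permutations with `σ(1) < σ(2) > σ(3) < σ(4) > ⋯`. -/
noncomputable def updownCount (j : ℕ) : ℕ :=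
  Nat.card {σ : Equiv.Perm (Fin j) //
    ∀ i : Fin j, ∀ h : (i : ℕ) + 1 < j,
      if (i : ℕ) % 2 = 0 then σ i < σ ⟨(i : ℕ) + 1, h⟩
      else σ ⟨(i : ℕ) + 1, h⟩ < σ i}

/-- `Ā_j = A_j / j!`. -/
noncomputable def Abar (j : ℕ) : ℝ := (updownCount j : ℝ) / (Nat.factorial j : ℝ)

/-- The quantity `X_N(p,q)` of Romik–Eremenko. -/
noncomputable def XN (N p q : ℕ) : ℝ :=
  (∑ i ∈ Finset.range (p / 2 + 1), ∑ j ∈ Finset.range (q / 2 + 1),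
      (-1 : ℝ) ^ (i + j) * Abar (N + 2 * i + 2 * j + 1) /
        ((Nat.factorial (p - 2 * i) : ℝ) * (Nat.factorial (q - 2 * j) : ℝ)))
  + (if Odd p then
      (-1 : ℝ) ^ ((p + 1) / 2) * ∑ j ∈ Finset.range (q / 2 + 1),
        (-1 : ℝ) ^ j * Abar (N + p + 2 * j + 1) / (Nat.factorial (q - 2 * j) : ℝ)
    else 0)
  + (if Odd q then
      (-1 : ℝ) ^ ((q + 1) / 2) * ∑ i ∈ Finset.range (p / 2 + 1),
        (-1 : ℝ) ^ i * Abar (N + q + 2 * i + 1) / (Nat.factorial (p - 2 * i) : ℝ)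
    else 0)
  + (if Odd p ∧ Odd q then (-1 : ℝ) ^ ((p + q) / 2 + 1) * Abar (N + p + q + 1) else 0)

/-- Iterates of the Elkies transfer operator `(Tf)(x) = ∫_0^{1−x} f(y) dy`
applied to `x ↦ x^p/p!`. -/
noncomputable def elkiesIter (p : ℕ) : ℕ → ℝ → ℝ
  | 0 => fun x => x ^ p / (Nat.factorial p : ℝ)
  | m + 1 => fun x => ∫ y in (0 : ℝ)..(1 - x), elkiesIter p m y

/-- Elkies transfer operator. -/
noncomputable def elkT (f : ℝ → ℝ) : ℝ → ℝ := fun x => ∫ y in (0 : ℝ)..(1 - x), f y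

theorem elkT_cont {f : ℝ → ℝ} (hf : Continuous f) : Continuous (elkT f) := by
  have h : Continuous (fun b : ℝ => ∫ y in (0 : ℝ)..b, f y) :=
    intervalIntegral.continuous_primitive (fun a b => hf.intervalIntegrable a b) 0
  exact h.comp (continuous_const.sub continuous_id)

theorem elkIter_cont (p m : ℕ) : Continuous (elkiesIter p m) := by
  induction m with
  | zero => simp only [elkiesIter]; fun_prop
  | succ m ih => exact elkT_cont ih

theorem elkT_hasDeriv {f : ℝ → ℝ} (hf : Continuous f) (x : ℝ) :
    HasDerivAt (elkT f) (-f (1 - x)) x := by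
  have h := (hf.integral_hasStrictDerivAt 0 (1 - x)).hasDerivAt
  have h2 : HasDerivAt (fun x : ℝ => 1 - x) (-1) x := by
    simpa using (hasDerivAt_id x).const_sub 1
  have := h.comp x h2
  exact this.congr_deriv (by simp)

theorem elkT_one (f : ℝ → ℝ) : elkT f 1 = 0 := by simp [elkT]

theorem elkT_unique {f g : ℝ → ℝ} (hf : Continuous f)
    (hg : ∀ x, HasDerivAt g (-f (1 - x)) x) (h1 : g 1 = 0) : elkT f = g := by
  have hd : ∀ x, HasDerivAt (fun x => elkT f x - g x) 0 x := by
    intro x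
    exact ((elkT_hasDeriv hf x).sub (hg x)).congr_deriv (by simp)
  have hc := is_const_of_deriv_eq_zero (f := fun x => elkT f x - g x)
    (fun x => (hd x).differentiableAt) (fun x => (hd x).deriv)
  funext x
  have := hc x 1
  simp only [elkT_one, h1] at this
  linarith

theorem elkT_lin {f g : ℝ → ℝ} (hf : Continuous f) (hg : Continuous g) (c : ℝ) :
    elkT (fun x => c * f x - g x) = fun x => c * elkT f x - elkT g x := by
  apply elkT_unique (by fun_prop)
  · intro x
    refine (((elkT_hasDeriv hf x).const_mul c).sub (elkT_hasDeriv hg x)).congr_deriv ?_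
    ring
  · simp [elkT_one]

theorem elkT_symm {f g : ℝ → ℝ} (hf : Continuous f) (hg : Continuous g) :
    (∫ x in (0 : ℝ)..1, elkT f x * g x) = ∫ x in (0 : ℝ)..1, f x * elkT g x := by
  have hG : ∀ x, HasDerivAt (fun x => elkT g (1 - x)) (g x) x := by
    intro x
    have h2 : HasDerivAt (fun x : ℝ => 1 - x) (-1) x := by
      simpa using (hasDerivAt_id x).const_sub 1
    have := (elkT_hasDeriv hg (1 - x)).comp x h2
    exact this.congr_deriv (by simp)
  have h := intervalIntegral.integral_mul_deriv_eq_deriv_mul (a := 0) (b := 1)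
    (fun x _ => elkT_hasDeriv hf x) (fun x _ => hG x)
    ((by fun_prop : Continuous fun x => -f (1 - x)).intervalIntegrable _ _)
    (hg.intervalIntegrable _ _)
  rw [h]
  have h3 := intervalIntegral.integral_comp_sub_left (a := 0) (b := 1)
    (fun x => f x * elkT g x) 1
  simp only [sub_self, sub_zero] at h3
  rw [← h3]
  simp [elkT_one]

theorem elkIter_succ (p m : ℕ) : elkiesIter p (m + 1) = elkT (elkiesIter p m) := rfl

theorem elkIter_zero_one (N : ℕ) : elkiesIter 1 N =
    fun x => 1 * elkiesIter 0 N x - elkiesIter 0 (N + 1) x := by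
  induction N with
  | zero => funext x; simp [elkiesIter]
  | succ N ih =>
    rw [elkIter_succ, ih, elkT_lin (elkIter_cont _ _) (elkIter_cont _ _)]
    rfl

theorem mono_hasDeriv (p : ℕ) (x : ℝ) :
    HasDerivAt (fun x : ℝ => x ^ (p + 1) / (Nat.factorial (p + 1) : ℝ))
      (x ^ p / (Nat.factorial p : ℝ)) x := by
  refine ((hasDerivAt_pow (p + 1) x).div_const _).congr_deriv ?_
  rw [Nat.factorial_succ]
  have : (Nat.factorial p : ℝ) ≠ 0 := by positivity
  have : (p : ℝ) + 1 ≠ 0 := by positivity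
  push_cast
  field_simp

theorem sub_hasDeriv (x : ℝ) : HasDerivAt (fun x : ℝ => 1 - x) (-1) x := by
  simpa using (hasDerivAt_id x).const_sub 1

theorem elkIter_one (p : ℕ) : elkiesIter p 1 =
    fun x => (1 - x) ^ (p + 1) / (Nat.factorial (p + 1) : ℝ) := by
  rw [elkIter_succ]
  apply elkT_unique (elkIter_cont _ _)
  · intro x
    have := (mono_hasDeriv p (1 - x)).comp x (sub_hasDeriv x)
    exact this.congr_deriv (by simp [elkiesIter])
  · simp

theorem elkIter_two (p : ℕ) : elkiesIter p 2 =
    fun x => 1 / (Nat.factorial (p + 2) : ℝ) - x ^ (p + 2) / (Nat.factorial (p + 2) : ℝ) := by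
  rw [elkIter_succ]
  apply elkT_unique (elkIter_cont _ _)
  · intro x
    rw [elkIter_one]
    exact ((mono_hasDeriv (p + 1) x).const_sub (1 / (Nat.factorial (p + 2) : ℝ))).congr_deriv (by simp)
  · simp

theorem elkIter_add_two (p N : ℕ) : elkiesIter (p + 2) N =
    fun x => (1 / (Nat.factorial (p + 2) : ℝ)) * elkiesIter 0 N x - elkiesIter p (N + 2) x := by
  induction N with
  | zero => funext x; rw [elkIter_two]; simp [elkiesIter]
  | succ N ih =>
    rw [elkIter_succ, ih, elkT_lin (elkIter_cont _ _) (elkIter_cont _ _)]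
    rfl

/-- the pairing -/
noncomputable def JN (N p q : ℕ) : ℝ :=
  ∫ x in (0 : ℝ)..1, elkiesIter p N x * elkiesIter q 0 x

theorem pair_shift (p q a b : ℕ) :
    (∫ x in (0 : ℝ)..1, elkiesIter p (a + b) x * elkiesIter q 0 x) =
      ∫ x in (0 : ℝ)..1, elkiesIter p a x * elkiesIter q b x := by
  have h : ∀ b a c, (∫ x in (0 : ℝ)..1, elkiesIter p (a + b) x * elkiesIter q c x) =
      ∫ x in (0 : ℝ)..1, elkiesIter p a x * elkiesIter q (c + b) x := by
    intro b
    induction b with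
    | zero => intro a c; rfl
    | succ b ih =>
      intro a c
      rw [← add_assoc, elkIter_succ, elkT_symm (elkIter_cont _ _) (elkIter_cont _ _),
        ← elkIter_succ, ih, show c + 1 + b = c + (b + 1) by omega]
  simpa using h b a 0

theorem JN_symm (N p q : ℕ) : JN N p q = JN N q p := by
  have := pair_shift p q 0 N
  rw [zero_add] at this
  unfold JN
  rw [this]
  exact intervalIntegral.integral_congr (fun x _ => mul_comm _ _)

theorem JN_lin (c : ℝ) (q : ℕ) {f g : ℝ → ℝ} (hf : Continuous f) (hg : Continuous g) :
    (∫ x in (0 : ℝ)..1, (c * f x - g x) * elkiesIter q 0 x) =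
    c * (∫ x in (0 : ℝ)..1, f x * elkiesIter q 0 x)
      - ∫ x in (0 : ℝ)..1, g x * elkiesIter q 0 x := by
  have hq := elkIter_cont q 0
  rw [← intervalIntegral.integral_const_mul, ← intervalIntegral.integral_sub]
  · exact intervalIntegral.integral_congr (fun x _ => by ring)
  · exact Continuous.intervalIntegrable (by fun_prop) _ _
  · exact Continuous.intervalIntegrable (by fun_prop) _ _

theorem JN_one (N q : ℕ) : JN N 1 q = JN N 0 q - JN (N + 1) 0 q := by
  unfold JN
  rw [elkIter_zero_one, JN_lin _ _ (elkIter_cont _ _) (elkIter_cont _ _), one_mul]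

theorem JN_add_two (N p q : ℕ) :
    JN N (p + 2) q = 1 / (Nat.factorial (p + 2) : ℝ) * JN N 0 q - JN (N + 2) p q := by
  unfold JN
  rw [elkIter_add_two, JN_lin _ _ (elkIter_cont _ _) (elkIter_cont _ _)]

/-- expansion functional -/
noncomputable def LL (p : ℕ) (a : ℕ → ℝ) : ℝ :=
  (∑ i ∈ Finset.range (p / 2 + 1), (-1 : ℝ) ^ i * a (2 * i) / (Nat.factorial (p - 2 * i) : ℝ))
  + (if Odd p then (-1 : ℝ) ^ ((p + 1) / 2) * a p else 0)

theorem LL_add_two (p : ℕ) (a : ℕ → ℝ) :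
    LL (p + 2) a = 1 / (Nat.factorial (p + 2) : ℝ) * a 0 - LL p (fun i => a (i + 2)) := by
  unfold LL
  rw [show (p + 2) / 2 + 1 = (p / 2 + 1) + 1 by omega, Finset.sum_range_succ']
  have h1 : ∀ i, p + 2 - 2 * (i + 1) = p - 2 * i := by intro i; omega
  have h2 : (p + 2 + 1) / 2 = (p + 1) / 2 + 1 := by omega
  have h3 : Odd (p + 2) ↔ Odd p := by simp [Nat.odd_add]
  simp only [h1, h2, h3, mul_add, pow_succ]
  have h4 : ∀ x y : ℝ, x * -1 * y = - (x * y) := by intro x y; ring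
  simp only [mul_one, h4, neg_div, Finset.sum_neg_distrib]
  split_ifs <;> simp <;> ring

theorem LL_expand (u : ℕ → ℕ → ℝ) (h1 : ∀ N, u N 1 = u N 0 - u (N + 1) 0)
    (h2 : ∀ N p, u N (p + 2) = 1 / (Nat.factorial (p + 2) : ℝ) * u N 0 - u (N + 2) p) :
    ∀ p N, u N p = LL p (fun i => u (N + i) 0) := by
  intro p
  induction p using Nat.twoStepInduction with
  | zero => intro N; simp [LL]
  | one => intro N; rw [h1]; simp [LL]; ring
  | more p ih _ =>
    intro N
    rw [h2, LL_add_two, ih]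
    simp [add_assoc, add_comm 2]

theorem JN_expand (N p q : ℕ) :
    JN N p q = LL p (fun i => LL q (fun j => JN (N + i + j) 0 0)) := by
  rw [LL_expand (fun N p => JN N p q) (fun N => JN_one N q) (fun N p => JN_add_two N p q) p N]
  congr 1
  funext i
  rw [JN_symm, LL_expand (fun N q => JN N q 0) (fun N => JN_one N 0)
    (fun N p => JN_add_two N p 0) q (N + i)]

theorem XN_eq_LL (N p q : ℕ) :
    XN N p q = LL p (fun i => LL q (fun j => Abar (N + i + j + 1))) := by
  unfold XN LL
  have e : ∀ i ∈ Finset.range (p / 2 + 1), (-1 : ℝ) ^ i *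
      (∑ j ∈ Finset.range (q / 2 + 1), (-1 : ℝ) ^ j * Abar (N + 2 * i + 2 * j + 1) /
        (Nat.factorial (q - 2 * j) : ℝ)
      + (if Odd q then (-1 : ℝ) ^ ((q + 1) / 2) * Abar (N + 2 * i + q + 1) else 0)) /
        (Nat.factorial (p - 2 * i) : ℝ) =
      ∑ j ∈ Finset.range (q / 2 + 1), (-1 : ℝ) ^ (i + j) * Abar (N + 2 * i + 2 * j + 1) /
        ((Nat.factorial (p - 2 * i) : ℝ) * (Nat.factorial (q - 2 * j) : ℝ))
      + (if Odd q then (-1 : ℝ) ^ ((q + 1) / 2) * ((-1 : ℝ) ^ i * Abar (N + q + 2 * i + 1) /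
        (Nat.factorial (p - 2 * i) : ℝ)) else 0) := by
    intro i _
    rw [mul_add, add_div, Finset.mul_sum, Finset.sum_div]
    congr 1
    · refine Finset.sum_congr rfl fun j _ => ?_
      rw [pow_add, ← div_div, div_right_comm]
      ring
    · split_ifs
      · rw [show N + 2 * i + q + 1 = N + q + 2 * i + 1 by omega]; ring
      · simp
  rw [Finset.sum_congr rfl e, Finset.sum_add_distrib]
  have e4 : Odd p → Odd q → (-1 : ℝ) ^ ((p + q) / 2 + 1)
      = (-1 : ℝ) ^ ((p + 1) / 2) * (-1 : ℝ) ^ ((q + 1) / 2) := by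
    intro hp hq
    obtain ⟨a, rfl⟩ := hp
    obtain ⟨b, rfl⟩ := hq
    rw [← pow_add]
    congr 1
    omega
  by_cases hp : Odd p <;> by_cases hq : Odd q
  · simp only [hp, hq, if_true, and_self, e4 hp hq, Finset.mul_sum]
    rw [mul_add, Finset.mul_sum]
    ring
  all_goals simp [hp, hq, Finset.mul_sum]

/-- Entringer numbers -/
def ent : ℕ → ℕ → ℕ
  | 0, k => if k = 0 then 1 else 0
  | n + 1, k => ∑ j ∈ Finset.range (n + 1 - k), ent n j

/-- Bernstein basis -/
noncomputable def BB (n k : ℕ) (x : ℝ) : ℝ :=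
  x ^ k / (Nat.factorial k : ℝ) * ((1 - x) ^ (n - k) / (Nat.factorial (n - k) : ℝ))

theorem mono_sub_hasDeriv (p : ℕ) (x : ℝ) :
    HasDerivAt (fun x : ℝ => (1 - x) ^ (p + 1) / (Nat.factorial (p + 1) : ℝ))
      (-((1 - x) ^ p / (Nat.factorial p : ℝ))) x := by
  have := (mono_hasDeriv p (1 - x)).comp x (sub_hasDeriv x)
  exact this.congr_deriv (by simp)

theorem ent_top (n : ℕ) : ent (n + 1) (n + 1) = 0 := by simp [ent]

theorem ent_diff (n k : ℕ) (hk : k ≤ n) : ent (n + 1) k = ent (n + 1) (k + 1) + ent n (n - k) := by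
  simp only [ent]
  rw [show n + 1 - k = (n - k) + 1 by omega, Finset.sum_range_succ,
    show n + 1 - (k + 1) = n - k by omega]

theorem BB_hasDeriv (n : ℕ) (c : ℕ → ℝ) (x : ℝ) :
    HasDerivAt (fun x => ∑ k ∈ Finset.range (n + 1 + 1), c k * BB (n + 1) k x)
      (∑ k ∈ Finset.range (n + 1), (c (k + 1) - c k) * BB n k x) x := by
  have h : ∀ k ∈ Finset.range (n + 1 + 1), HasDerivAt (fun x => c k * BB (n + 1) k x)
      (c k * ((if k = 0 then 0 else BB n (k - 1) x) - (if k = n + 1 then 0 else BB n k x))) x := by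
    intro k hk
    apply HasDerivAt.const_mul
    rw [Finset.mem_range] at hk
    rcases Nat.eq_zero_or_pos k with rfl | hk0
    · refine ((mono_sub_hasDeriv n x).congr_deriv ?_).congr_of_eventuallyEq ?_
      · simp [BB]
      · exact Filter.Eventually.of_forall fun y => by simp [BB]
    · obtain ⟨k, rfl⟩ : ∃ l, k = l + 1 := ⟨k - 1, by omega⟩
      by_cases hkn : k = n
      · subst hkn
        refine ((mono_hasDeriv k x).congr_deriv ?_).congr_of_eventuallyEq ?_
        · simp [BB]
        · exact Filter.Eventually.of_forall fun y => by simp [BB]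
      · obtain ⟨d, rfl⟩ : ∃ d, n = k + 1 + d := ⟨n - k - 1, by omega⟩
        refine (((mono_hasDeriv k x).mul (mono_sub_hasDeriv d x)).congr_deriv
          ?_).congr_of_eventuallyEq ?_
        · simp only [BB, Nat.add_sub_cancel_left, Nat.add_sub_cancel]
          rw [if_neg (by omega), if_neg (by omega), show k + 1 + d - k = d + 1 by omega]
          ring
        · exact Filter.Eventually.of_forall fun y => by
            simp only [BB, Pi.mul_apply]
            rw [show k + 1 + d + 1 - (k + 1) = d + 1 by omega]
  refine (HasDerivAt.fun_sum h).congr_deriv ?_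
  simp only [mul_sub, sub_mul, Finset.sum_sub_distrib]
  congr 1
  · rw [Finset.sum_range_succ']
    simp
  · rw [Finset.sum_range_succ]
    simp only [if_true, mul_zero, add_zero]
    refine Finset.sum_congr rfl fun k hk => ?_
    rw [Finset.mem_range] at hk
    rw [if_neg (by omega)]

theorem elkIter_ent (n : ℕ) : elkiesIter 0 n =
    fun x => ∑ k ∈ Finset.range (n + 1), (ent n k : ℝ) * BB n k x := by
  induction n with
  | zero => funext x; simp [elkiesIter, ent, BB]
  | succ n ih =>
    rw [elkIter_succ]
    apply elkT_unique (elkIter_cont _ _)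
    · intro x
      refine (BB_hasDeriv n (fun k => (ent (n + 1) k : ℝ)) x).congr_deriv ?_
      rw [ih]
      simp only
      rw [← Finset.sum_range_reflect, ← Finset.sum_neg_distrib]
      refine Finset.sum_congr rfl fun k hk => ?_
      rw [Finset.mem_range] at hk
      rw [show n + 1 - 1 - k = n - k by omega, ent_diff n (n - k) (by omega),
        show n - (n - k) = k by omega]
      have : BB n (n - k) x = BB n k (1 - x) := by
        simp only [BB]
        rw [show n - (n - k) = k by omega]
        ring_nf
      rw [this]
      push_cast
      ring
    · apply Finset.sum_eq_zero
      intro k hk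
      rw [Finset.mem_range] at hk
      by_cases h : k = n + 1
      · subst h; simp [ent_top]
      · simp only [BB, sub_self]
        rw [zero_pow (by omega)]
        simp

theorem JN_zero_ent (N : ℕ) : JN N 0 0 = (ent (N + 1) 0 : ℝ) / (Nat.factorial (N + 1) : ℝ) := by
  have h : JN N 0 0 = elkiesIter 0 (N + 1) 0 := by
    simp [JN, elkiesIter]
  rw [h, elkIter_ent]
  beta_reduce
  rw [Finset.sum_range_succ']
  simp [BB]
  ring

/-- up-down predicate -/
def UD (j : ℕ) (σ : Equiv.Perm (Fin j)) : Prop :=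
  ∀ i : Fin j, ∀ h : (i : ℕ) + 1 < j,
      if (i : ℕ) % 2 = 0 then σ i < σ ⟨(i : ℕ) + 1, h⟩
      else σ ⟨(i : ℕ) + 1, h⟩ < σ i

/-- prepend a value -/
def prep (n : ℕ) (k : Fin (n + 1)) (τ : Equiv.Perm (Fin n)) : Equiv.Perm (Fin (n + 1)) :=
  ((finSuccEquiv' 0).trans (Equiv.optionCongr (τ.trans Fin.revPerm))).trans (finSuccEquiv' k).symm

theorem prep_zero (n : ℕ) (k : Fin (n + 1)) (τ : Equiv.Perm (Fin n)) : prep n k τ 0 = k := by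
  simp [prep]

theorem prep_succ (n : ℕ) (k : Fin (n + 1)) (τ : Equiv.Perm (Fin n)) (i : Fin n) :
    prep n k τ i.succ = k.succAbove (Fin.rev (τ i)) := by
  have h : finSuccEquiv' 0 i.succ = some i := by
    rw [← Fin.succAbove_zero_apply, finSuccEquiv'_succAbove]
  simp [prep, h]

theorem prep_bij (n : ℕ) :
    Function.Bijective (fun x : Fin (n + 1) × Equiv.Perm (Fin n) => prep n x.1 x.2) := by
  rw [Fintype.bijective_iff_injective_and_card]
  constructor
  · rintro ⟨k, τ⟩ ⟨k', τ'⟩ h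
    simp only at h
    have h0 : k = k' := by rw [← prep_zero n k τ, h, prep_zero]
    subst h0
    congr 1
    ext i
    have := prep_succ n k τ i
    rw [h, prep_succ] at this
    have := Fin.rev_injective (Fin.succAbove_right_injective this)
    rw [this]
  · simp [Fintype.card_perm, Nat.factorial_succ]

theorem UD_prep (n : ℕ) (k : Fin (n + 2)) (τ : Equiv.Perm (Fin (n + 1))) :
    UD (n + 2) (prep (n + 1) k τ) ↔ UD (n + 1) τ ∧ (τ 0 : ℕ) + k < n + 1 := by
  have key : ∀ i : Fin (n + 1), ∀ h : (i : ℕ) + 1 < n + 1,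
      prep (n + 1) k τ ⟨(i : ℕ) + 1 + 1, by omega⟩
        = k.succAbove (Fin.rev (τ ⟨(i : ℕ) + 1, h⟩)) := by
    intro i h
    exact prep_succ (n + 1) k τ ⟨(i : ℕ) + 1, h⟩
  have first : k < k.succAbove (Fin.rev (τ 0)) ↔ (τ 0 : ℕ) + k < n + 1 := by
    rw [Fin.lt_succAbove_iff_le_castSucc, Fin.le_def]
    have := (τ 0).isLt
    simp only [Fin.val_castSucc, Fin.val_rev]
    omega
  have h1 : prep (n + 1) k τ ⟨0 + 1, by omega⟩ = k.succAbove (Fin.rev (τ 0)) :=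
    prep_succ (n + 1) k τ 0
  constructor
  · intro H
    refine ⟨?_, ?_⟩
    · intro i h
      have := H i.succ (by simp; omega)
      simp only [Fin.val_succ] at this
      rw [key i h, prep_succ] at this
      have hs := Fin.strictMono_succAbove k
      by_cases hi : (i : ℕ) % 2 = 0
      · rw [if_neg (by omega), hs.lt_iff_lt, Fin.rev_lt_rev] at this
        rwa [if_pos hi]
      · rw [if_pos (by omega), hs.lt_iff_lt, Fin.rev_lt_rev] at this
        rwa [if_neg hi]
    · have := H 0 (by simp)
      simp only [Fin.val_zero, Nat.zero_mod, if_true] at this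
      rw [h1, prep_zero] at this
      exact first.1 this
  · rintro ⟨H, hf⟩ i
    refine Fin.cases ?_ (fun i => ?_) i
    · intro h
      simp only [Fin.val_zero, Nat.zero_mod, if_true]
      rw [h1, prep_zero]
      exact first.2 hf
    · intro h
      simp only [Fin.val_succ] at h ⊢
      have h' : (i : ℕ) + 1 < n + 1 := by omega
      have := H i h'
      rw [key i h', prep_succ]
      have hs := Fin.strictMono_succAbove k
      by_cases hi : (i : ℕ) % 2 = 0
      · rw [if_pos hi] at this
        rwa [if_neg (by omega), hs.lt_iff_lt, Fin.rev_lt_rev]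
      · rw [if_neg hi] at this
        rwa [if_pos (by omega), hs.lt_iff_lt, Fin.rev_lt_rev]

open Classical in
theorem card_lt_sum (n m : ℕ) :
    (Finset.univ.filter fun τ : Equiv.Perm (Fin (n + 1)) => UD (n + 1) τ ∧ (τ 0 : ℕ) < m).card =
    ∑ j ∈ Finset.range m,
      (Finset.univ.filter fun τ : Equiv.Perm (Fin (n + 1)) => UD (n + 1) τ ∧ (τ 0 : ℕ) = j).card := by
  rw [Finset.card_eq_sum_card_fiberwise (f := fun τ : Equiv.Perm (Fin (n + 1)) => (τ 0 : ℕ))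
    (t := Finset.range m)]
  · refine Finset.sum_congr rfl fun j hj => ?_
    rw [Finset.mem_range] at hj
    congr 1
    ext τ
    simp only [Finset.mem_filter, Finset.mem_univ, true_and]
    constructor
    · rintro ⟨⟨a, b⟩, c⟩; exact ⟨a, c⟩
    · rintro ⟨a, c⟩; exact ⟨⟨a, by omega⟩, c⟩
  · intro τ hτ
    simp at hτ ⊢
    exact hτ.2

open Classical in
theorem card_ent (n : ℕ) : ∀ k : ℕ,
    (Finset.univ.filter fun τ : Equiv.Perm (Fin (n + 1)) => UD (n + 1) τ ∧ (τ 0 : ℕ) = k).card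
      = ent n k := by
  induction n with
  | zero =>
    intro k
    have hu : ∀ τ : Equiv.Perm (Fin 1), UD 1 τ := by
      intro τ i h
      omega
    by_cases hk : k = 0
    · subst hk
      simp [hu, ent]
    · have : ¬ (0 = k) := fun h => hk h.symm
      simp [ent, hk, this]
  | succ n ih =>
    intro k
    simp only [ent]
    rw [← Finset.sum_congr rfl (fun j _ => ih j), ← card_lt_sum]
    by_cases hk : k < n + 2
    · symm
      apply Finset.card_bij (fun τ _ => prep (n + 1) ⟨k, hk⟩ τ)
      · intro τ hτ
        simp only [Finset.mem_filter, Finset.mem_univ, true_and] at hτ ⊢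
        rw [UD_prep, prep_zero]
        refine ⟨⟨hτ.1, ?_⟩, rfl⟩
        simp only
        omega
      · intro τ _ τ' _ h
        have := (prep_bij (n + 1)).1 (a₁ := (⟨k, hk⟩, τ)) (a₂ := (⟨k, hk⟩, τ')) h
        exact (Prod.mk.inj this).2
      · intro σ hσ
        simp only [Finset.mem_filter, Finset.mem_univ, true_and] at hσ
        obtain ⟨⟨k', τ⟩, rfl⟩ := (prep_bij (n + 1)).2 σ
        simp only [UD_prep, prep_zero] at hσ
        have : k' = ⟨k, hk⟩ := Fin.ext hσ.2
        subst this
        refine ⟨τ, ?_, rfl⟩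
        simp only [Finset.mem_filter, Finset.mem_univ, true_and]
        have h2 := hσ.1.2
        simp only at h2
        exact ⟨hσ.1.1, by omega⟩
    · rw [show n + 1 - k = 0 by omega]
      rw [Finset.card_eq_zero.2, Finset.card_eq_zero.2]
      · apply Finset.filter_false_of_mem
        rintro τ - ⟨-, h⟩
        omega
      · apply Finset.filter_false_of_mem
        rintro τ - ⟨-, h⟩
        have := (τ 0).isLt
        omega

theorem updown_ent (n : ℕ) : updownCount (n + 1) = ent (n + 1) 0 := by
  classical
  have h : updownCount (n + 1) = Nat.card {σ : Equiv.Perm (Fin (n + 1)) // UD (n + 1) σ} := rfl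
  rw [h, Nat.card_eq_fintype_card, Fintype.card_subtype]
  simp only [ent]
  rw [← Finset.sum_congr rfl (fun j _ => card_ent n j), ← card_lt_sum]
  congr 1
  ext τ
  have := (τ 0).isLt
  simp only [Finset.mem_filter, Finset.mem_univ, true_and, Nat.sub_zero]
  exact ⟨fun h => ⟨h, this⟩, fun h => h.1⟩

theorem JN_zero (N : ℕ) : JN N 0 0 = Abar (N + 1) := by
  rw [JN_zero_ent, Abar, updown_ent]

/-- `X_N(p,q) = ⟨T^N(x^p/p!), x^q/q!⟩` where `T` is the Elkies transfer
operator. -/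
theorem XN_transfer (N p q : ℕ) :
    (∫ x in (0 : ℝ)..1, elkiesIter p N x * (x ^ q / (Nat.factorial q : ℝ))) =
      XN N p q := by
  rw [XN_eq_LL]
  simp only [← JN_zero]
  exact JN_expand N p q
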